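/- arXiv:2603.01308 — 5 statements merged into one kernel-verified Lean document; each statement's English description precedes it below -/
import Mathlib

section
/- Let X be a frame and let (k_i)_{i : ι} be a family of Scott-continuous nuclei on X. For a list s = [i₀, …, i_{n−1}] of indices, let k*_s denote the composite k_{i_{n−1}} ∘ ⋯ ∘ k_{i₀} (the identity function for the empty list). Then the function j defined by j U = ⨆ (s : List ι), k*_s U is a Scott-continuous nucleus on X; moreover k_i U ≤ j U for every index i and every U : X, and for every nucleus m on X with k_i ≤ m pointwise for all i one has j ≤ m pointwise. Hence j is the least upper bound of the family (k_i) in the pointwise-ordered poset of nuclei on X. -/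
/-- A nucleus on a frame: an inflationary, binary-meet-preserving, idempotent endofunction. -/
def IsNucleusFun {X : Type*} [Order.Frame X] (j : X → X) : Prop :=
  (∀ V, V ≤ j V) ∧ (∀ V W, j (V ⊓ W) = j V ⊓ j W) ∧ (∀ V, j (j V) = j V)

/-- Scott continuity: preservation of suprema of nonempty directed sets. -/
def ScottCont {X : Type*} [Order.Frame X] (f : X → X) : Prop :=
  ∀ S : Set X, S.Nonempty → DirectedOn (· ≤ ·) S → f (sSup S) = ⨆ s ∈ S, f s

/-- The finite composition `k*_s = k_{i_{n-1}} ∘ ⋯ ∘ k_{i₀}` for a list `s = [i₀, …, i_{n-1}]`,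
the identity for the empty list. -/
def finComp {X ι : Type*} (k : ι → X → X) (s : List ι) (U : X) : X :=
  s.foldl (fun V i => k i V) U

section finComp

variable {X ι : Type*}

theorem finComp_append (k : ι → X → X) (s t : List ι) (U : X) :
    finComp k (s ++ t) U = finComp k t (finComp k s U) :=
  List.foldl_append

variable [Order.Frame X]

theorem monotone_of_map_inf {f : X → X} (h : ∀ V W, f (V ⊓ W) = f V ⊓ f W) : Monotone f :=
  fun V W hVW => by
    rw [← inf_eq_left, ← h, inf_eq_left.mpr hVW]

variable {k : ι → X → X}

theorem le_finComp (h : ∀ i V, V ≤ k i V) (s : List ι) (U : X) : U ≤ finComp k s U := by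
  induction s generalizing U with
  | nil => exact le_rfl
  | cons i s ih => exact (h i U).trans (ih (k i U))

theorem finComp_inf (h : ∀ i V W, k i (V ⊓ W) = k i V ⊓ k i W) (s : List ι) (V W : X) :
    finComp k s (V ⊓ W) = finComp k s V ⊓ finComp k s W := by
  induction s generalizing V W with
  | nil => rfl
  | cons i s ih =>
    change finComp k s (k i (V ⊓ W)) = _
    rw [h, ih]
    rfl

theorem scottCont_finComp (hmono : ∀ i, Monotone (k i)) (hsc : ∀ i, ScottCont (k i))
    (s : List ι) : ScottCont (finComp k s) := by
  induction s with
  | nil => exact fun S _ _ => sSup_eq_iSup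
  | cons i s ih =>
    intro S hne hdir
    change finComp k s (k i (sSup S)) = ⨆ V ∈ S, finComp k s (k i V)
    rw [hsc i S hne hdir, ← sSup_image, ih _ (hne.image _), iSup_image]
    exact hdir.mono_comp (fun _ _ hVW => hmono i hVW)

theorem finComp_le {m : X → X} (hm : IsNucleusFun m) (h : ∀ i U, k i U ≤ m U)
    (s : List ι) (U : X) : finComp k s U ≤ m U := by
  induction s generalizing U with
  | nil => exact hm.1 U
  | cons i s ih =>
    exact (ih (k i U)).trans ((monotone_of_map_inf hm.2.1 (h i U)).trans_eq (hm.2.2 U))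

theorem finComp_le_append_left (h : ∀ i V, V ≤ k i V) (s t : List ι) (U : X) :
    finComp k s U ≤ finComp k (s ++ t) U := by
  rw [finComp_append]
  exact le_finComp h t _

theorem finComp_le_append_right (h : ∀ i V, V ≤ k i V)
    (hinf : ∀ i V W, k i (V ⊓ W) = k i V ⊓ k i W) (s t : List ι) (U : X) :
    finComp k t U ≤ finComp k (s ++ t) U := by
  rw [finComp_append]
  exact monotone_of_map_inf (finComp_inf hinf t) (le_finComp h s U)

theorem directed_finComp (h : ∀ i V, V ≤ k i V)
    (hinf : ∀ i V W, k i (V ⊓ W) = k i V ⊓ k i W) (U : X) :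
    Directed (· ≤ ·) (fun s : List ι => finComp k s U) := fun s t =>
  ⟨s ++ t, finComp_le_append_left h s t U, finComp_le_append_right h hinf s t U⟩

end finComp

/-- The pointwise supremum of all finite compositions of a family of Scott-continuous nuclei
is a Scott-continuous nucleus, and it is the least upper bound of the family in the
pointwise-ordered poset of nuclei. -/
theorem stmt0 {X ι : Type*} [Order.Frame X] (k : ι → X → X)
    (hnuc : ∀ i, IsNucleusFun (k i)) (hsc : ∀ i, ScottCont (k i)) :
    IsNucleusFun (fun U => ⨆ s : List ι, finComp k s U) ∧
    ScottCont (fun U => ⨆ s : List ι, finComp k s U) ∧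
    (∀ i U, k i U ≤ ⨆ s : List ι, finComp k s U) ∧
    (∀ m : X → X, IsNucleusFun m → (∀ i U, k i U ≤ m U) →
      ∀ U, (⨆ s : List ι, finComp k s U) ≤ m U) := by
  have hle i V : V ≤ k i V := (hnuc i).1 V
  have hinf i V W : k i (V ⊓ W) = k i V ⊓ k i W := (hnuc i).2.1 V W
  have hcont := scottCont_finComp (fun i => monotone_of_map_inf (hinf i)) hsc
  have hinfl (U : X) : U ≤ ⨆ s : List ι, finComp k s U :=
    le_iSup (fun s => finComp k s U) []
  refine ⟨⟨hinfl, fun V W => le_antisymm ?_ ?_, fun V => le_antisymm ?_ (hinfl _)⟩,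
    fun S hne hdir => ?_, fun i U => le_iSup (fun s => finComp k s U) [i],
    fun m hm h U => iSup_le fun s => finComp_le hm h s U⟩
  · simp only [finComp_inf hinf]
    exact le_inf (iSup_mono fun _ => inf_le_left) (iSup_mono fun _ => inf_le_right)
  · simp only [iSup_inf_iSup]
    refine iSup_le fun ⟨s, t⟩ => le_iSup_of_le (s ++ t) ?_
    rw [finComp_inf hinf]
    exact inf_le_inf (finComp_le_append_left hle s t V)
      (finComp_le_append_right hle hinf s t W)
  · refine iSup_le fun t => ?_
    change finComp k t (sSup _) ≤ _
    rw [hcont t _ (Set.range_nonempty _) (directed_finComp hle hinf V).directedOn_range,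
      iSup_range]
    refine iSup_le fun s => ?_
    rw [← finComp_append]
    exact le_iSup (fun s => finComp k s V) (s ++ t)
  · simp only [hcont _ S hne hdir]
    rw [iSup_comm]
    exact iSup_congr fun V => iSup_comm
end

section
/- Let X be a frame, ι a nonempty type, and (k_i)_{i : ι} a family of Scott-continuous nuclei on X that is directed in the pointwise order (for all i, i' there exists i'' with k_i ≤ k_{i''} and k_{i'} ≤ k_{i''} pointwise). Then the pointwise supremum U ↦ ⨆ i, k_i U is itself a Scott-continuous nucleus on X, and it is the least nucleus on X lying above every k_i in the pointwise order. -/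
theorem IsNucleusFun.monotone {X : Type*} [Order.Frame X] {j : X → X} (hj : IsNucleusFun j) :
    Monotone j := fun V W h => by
  have := hj.2.1 V W
  rw [inf_eq_left.2 h] at this
  exact inf_eq_left.1 this.symm

theorem directedOn_range_of_pointwise {X ι : Type*} [Order.Frame X] {k : ι → X → X}
    (hdir : ∀ i i', ∃ i'', (∀ U, k i U ≤ k i'' U) ∧ (∀ U, k i' U ≤ k i'' U)) (U : X) :
    DirectedOn (· ≤ ·) (Set.range fun i => k i U) := by
  rintro _ ⟨i, rfl⟩ _ ⟨i', rfl⟩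
  obtain ⟨l, hl, hl'⟩ := hdir i i'
  exact ⟨_, ⟨l, rfl⟩, hl U, hl' U⟩

theorem ScottCont.iSup {X ι : Type*} [Order.Frame X] {k : ι → X → X}
    (hsc : ∀ i, ScottCont (k i)) : ScottCont (fun U => ⨆ i, k i U) := by
  intro S hne hS
  simp only [fun i => hsc i S hne hS]
  rw [iSup_comm]
  exact iSup_congr fun _ => iSup_comm

/-- Scott continuity is what makes the directed pointwise supremum idempotent. -/
theorem IsNucleusFun.iSup_of_directed {X ι : Type*} [Order.Frame X] [Nonempty ι] {k : ι → X → X}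
    (hnuc : ∀ i, IsNucleusFun (k i)) (hsc : ∀ i, ScottCont (k i))
    (hdir : ∀ i i', ∃ i'', (∀ U, k i U ≤ k i'' U) ∧ (∀ U, k i' U ≤ k i'' U)) :
    IsNucleusFun (fun U => ⨆ i, k i U) := by
  have infl (V : X) : V ≤ ⨆ i, k i V :=
    ((hnuc (Classical.arbitrary ι)).1 V).trans (le_iSup (fun i => k i V) _)
  refine ⟨infl, fun V W => ?_, fun V => le_antisymm (iSup_le fun i => ?_) (infl _)⟩
  · simp only [fun i => (hnuc i).2.1 V W]
    refine le_antisymm (le_inf (iSup_mono fun _ => inf_le_left) (iSup_mono fun _ => inf_le_right)) ?_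
    rw [iSup_inf_iSup]
    refine iSup_le fun p => ?_
    obtain ⟨l, hl, hl'⟩ := hdir p.1 p.2
    exact (inf_le_inf (hl V) (hl' W)).trans (le_iSup (fun i => k i V ⊓ k i W) l)
  · change k i (sSup (Set.range fun i' => k i' V)) ≤ _
    rw [hsc i _ (Set.range_nonempty _) (directedOn_range_of_pointwise hdir V), iSup_range]
    refine iSup_le fun i' => ?_
    obtain ⟨l, hl, hl'⟩ := hdir i i'
    calc k i (k i' V) ≤ k l (k i' V) := hl _
      _ ≤ k l (k l V) := (hnuc l).monotone (hl' V)
      _ = k l V := (hnuc l).2.2 V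
      _ ≤ ⨆ i, k i V := le_iSup (fun i => k i V) l

/-- The pointwise supremum of a nonempty pointwise-directed family of Scott-continuous nuclei
is a Scott-continuous nucleus, and it is the least nucleus pointwise above every member. -/
theorem stmt2 {X ι : Type*} [Order.Frame X] [Nonempty ι] (k : ι → X → X)
    (hnuc : ∀ i, IsNucleusFun (k i)) (hsc : ∀ i, ScottCont (k i))
    (hdir : ∀ i i', ∃ i'', (∀ U, k i U ≤ k i'' U) ∧ (∀ U, k i' U ≤ k i'' U)) :
    IsNucleusFun (fun U => ⨆ i, k i U) ∧
    ScottCont (fun U => ⨆ i, k i U) ∧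
    (∀ i U, k i U ≤ ⨆ i', k i' U) ∧
    (∀ m : X → X, IsNucleusFun m → (∀ i U, k i U ≤ m U) →
      ∀ U, (⨆ i, k i U) ≤ m U) := by
  exact ⟨IsNucleusFun.iSup_of_directed hnuc hsc hdir, ScottCont.iSup hsc,
    fun i U => le_iSup (fun i => k i U) i, fun _ _ hm U => iSup_le fun i => hm i U⟩
end

section
/- Let α be a compactly generated complete lattice equipped with the Scott topology. Then: (a) α is a compact topological space; (b) the compact open subsets of α form a basis for the topology (every Scott-open set is a union of compact open sets); and (c) the intersection of any two compact open subsets of α is again a compact open subset. -/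
namespace Topology.IsScott

theorem isCompact_Ici {α : Type*} [Preorder α] {D : Set (Set α)} [TopologicalSpace α]
    [Topology.IsScott α D] (a : α) : IsCompact (Set.Ici a) := by
  intro f _ hf
  refine ⟨a, Set.self_mem_Ici, ClusterPt.of_le_nhds (hf.trans ?_)⟩
  intro s hs
  obtain ⟨t, hts, ht, hat⟩ := mem_nhds_iff.1 hs
  exact Filter.mem_principal.2 (((isUpperSet_of_isOpen (D := D) ht).Ici_subset hat).trans hts)

variable {α : Type*} [CompleteLattice α] [TopologicalSpace α] [Topology.IsScott α Set.univ]

theorem isOpen_Ici_of_isCompactElement {k : α} (hk : IsCompactElement k) :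
    IsOpen (Set.Ici k) := by
  rw [isOpen_iff_isUpperSet_and_dirSupInaccOn (D := Set.univ)]
  refine ⟨isUpperSet_Ici k, fun d _ hne hdir a ha hka => ?_⟩
  obtain ⟨x, hxd, hkx⟩ := hk d a hne hdir ha hka
  exact ⟨x, hxd, hkx⟩

theorem isTopologicalBasis_range_Ici [IsCompactlyGenerated α] :
    TopologicalSpace.IsTopologicalBasis
      (Set.range fun k : {k : α // IsCompactElement k} => Set.Ici (k : α)) := by
  refine TopologicalSpace.isTopologicalBasis_of_isOpen_of_nhds ?_ fun a U haU hU => ?_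
  · rintro _ ⟨k, rfl⟩
    exact isOpen_Ici_of_isCompactElement k.2
  · obtain ⟨hup, hinacc⟩ := (isOpen_iff_isUpperSet_and_dirSupInaccOn (D := Set.univ)).1 hU
    have hdir : DirectedOn (· ≤ ·) {c : α | IsCompactElement c ∧ c ≤ a} :=
      fun x hx y hy => ⟨x ⊔ y, ⟨by
        classical
        simpa using CompleteLattice.isCompactElement_finsetSup (f := id) {x, y}
          (by simp [hx.1, hy.1]), sup_le hx.2 hy.2⟩, le_sup_left, le_sup_right⟩
    have hlub : IsLUB {c : α | IsCompactElement c ∧ c ≤ a} a := by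
      simpa only [sSup_compact_le_eq] using isLUB_sSup {c : α | IsCompactElement c ∧ c ≤ a}
    have hne : {c : α | IsCompactElement c ∧ c ≤ a}.Nonempty :=
      ⟨⊥, CompleteLattice.isCompactElement_finsetSup (f := (id : α → α)) ∅ (by simp), bot_le⟩
    obtain ⟨k, ⟨hk, hka⟩, hkU⟩ := hinacc (Set.mem_univ _) hne hdir hlub haU
    exact ⟨Set.Ici k, ⟨⟨k, hk⟩, rfl⟩, hka, hup.Ici_subset hkU⟩

end Topology.IsScott


/-- A compactly generated complete lattice, equipped with its Scott topology, is a compact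
space; its compact open subsets form a basis (every open set is a union of compact open sets);
and compact open subsets are closed under binary intersections. -/
theorem stmt14 {α : Type*} [CompleteLattice α] [IsCompactlyGenerated α]
    [TopologicalSpace α] [Topology.IsScott α Set.univ] :
    CompactSpace α ∧
    (∀ U : Set α, IsOpen U → ∃ 𝒮 : Set (Set α),
      (∀ V ∈ 𝒮, IsOpen V ∧ IsCompact V) ∧ U = ⋃₀ 𝒮) ∧
    (∀ U V : Set α, IsOpen U → IsCompact U → IsOpen V → IsCompact V →
      IsOpen (U ∩ V) ∧ IsCompact (U ∩ V)) := by
  have hbasis := Topology.IsScott.isTopologicalBasis_range_Ici (α := α)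
  have : QuasiSeparatedSpace α := .of_isTopologicalBasis hbasis fun i j => by
    rw [Set.Ici_inter_Ici]
    exact Topology.IsScott.isCompact_Ici (D := Set.univ) _
  refine ⟨⟨?_⟩, fun U hU => ?_, fun U V hU hUc hV hVc =>
    ⟨hU.inter hV, QuasiSeparatedSpace.inter_isCompact U V hU hUc hV hVc⟩⟩
  · rw [← Set.Ici_bot]
    exact Topology.IsScott.isCompact_Ici (D := Set.univ) _
  · obtain ⟨𝒮, h𝒮, hU𝒮⟩ := hbasis.open_eq_sUnion hU
    refine ⟨𝒮, fun V hV => ⟨hbasis.isOpen (h𝒮 hV), ?_⟩, hU𝒮⟩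
    obtain ⟨k, rfl⟩ := h𝒮 hV
    exact Topology.IsScott.isCompact_Ici (D := Set.univ) _
end

section
/- Let α be a compactly generated complete lattice equipped with the Scott topology. The map sending a point x : α to the function U ↦ (x ∈ U) on the frame of open sets of α is a bijection from α onto the set of frame homomorphisms from the frame of Scott-open sets of α to the frame Prop. (Equivalently: α is in bijection with the points of its Scott locale, i.e., with the completely prime filters of Scott-open sets.) -/
open TopologicalSpace Topology

section CompactElement

variable {α : Type*}

theorem isCompactElement_bot [PartialOrder α] [OrderBot α] : IsCompactElement (⊥ : α) :=
  fun _ _ ⟨x, hx⟩ _ _ _ => ⟨x, hx, bot_le⟩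

theorem IsCompactElement.sup [SemilatticeSup α] {c d : α} (hc : IsCompactElement c)
    (hd : IsCompactElement d) : IsCompactElement (c ⊔ d) := by
  intro s u hs hdir hu hle
  obtain ⟨x, hx, hcx⟩ := hc s u hs hdir hu (le_sup_left.trans hle)
  obtain ⟨y, hy, hdy⟩ := hd s u hs hdir hu (le_sup_right.trans hle)
  obtain ⟨z, hz, hxz, hyz⟩ := hdir x hx y hy
  exact ⟨z, hz, sup_le (hcx.trans hxz) (hdy.trans hyz)⟩

theorem directedOn_isCompactElement_le [SemilatticeSup α] (x : α) :
    DirectedOn (· ≤ ·) {c : α | IsCompactElement c ∧ c ≤ x} :=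
  fun c hc d hd => ⟨c ⊔ d, ⟨hc.1.sup hd.1, sup_le hc.2 hd.2⟩, le_sup_left, le_sup_right⟩

end CompactElement

namespace Topology.IsScott

/-- The Scott-open set of all elements above a compact element. -/
def opensIci {α : Type*} [PartialOrder α] [TopologicalSpace α] [IsScott α Set.univ]
    (c : α) (hc : IsCompactElement c) : Opens α where
  carrier := Set.Ici c
  is_open' := by
    rw [isOpen_iff_isUpperSet_and_dirSupInaccOn (D := Set.univ), dirSupInaccOn_univ]
    exact ⟨isUpperSet_Ici c, fun d hd hdir a ha hca => hc d a hd hdir ha hca⟩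

@[simp]
theorem mem_opensIci {α : Type*} [PartialOrder α] [TopologicalSpace α] [IsScott α Set.univ]
    {c : α} {hc : IsCompactElement c} {x : α} : x ∈ opensIci c hc ↔ c ≤ x :=
  Iff.rfl

theorem opensIci_le {α : Type*} [PartialOrder α] [TopologicalSpace α] [IsScott α Set.univ]
    {c : α} {hc : IsCompactElement c} {U : Opens α} (hU : c ∈ U) : opensIci c hc ≤ U :=
  fun _ hx => isUpperSet_of_isOpen (D := Set.univ) U.isOpen hx hU

variable {α : Type*} [CompleteLattice α] [TopologicalSpace α] [IsScott α Set.univ]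

theorem exists_mem_of_sSup_mem {s : Set α} {U : Opens α} (hs : s.Nonempty)
    (hdir : DirectedOn (· ≤ ·) s) (hU : sSup s ∈ U) : ∃ c ∈ s, c ∈ U :=
  dirSupInaccOn_univ.1 (isOpen_iff_isUpperSet_and_dirSupInaccOn (D := Set.univ).1 U.isOpen).2
    hs hdir (isLUB_sSup s) hU

/-- The compact elements whose principal upper set belongs to the completely prime filter `p`. -/
def compactElementsOf (p : FrameHom (Opens α) Prop) : Set α :=
  {c | ∃ hc : IsCompactElement c, p (opensIci c hc)}

variable [IsCompactlyGenerated α]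

theorem exists_isCompactElement_mem {x : α} {U : Opens α} (hx : x ∈ U) :
    ∃ c, IsCompactElement c ∧ c ≤ x ∧ c ∈ U := by
  rw [← sSup_compact_le_eq x] at hx
  obtain ⟨c, hc, hcU⟩ := exists_mem_of_sSup_mem
    (s := {c : α | IsCompactElement c ∧ c ≤ x}) ⟨⊥, isCompactElement_bot, bot_le⟩
    (directedOn_isCompactElement_le x) hx
  exact ⟨c, hc.1, hc.2, hcU⟩

theorem localePointOfSpacePoint_injective :
    Function.Injective (Locale.localePointOfSpacePoint α) := by
  have key : ∀ x y : α, Locale.localePointOfSpacePoint α x = Locale.localePointOfSpacePoint α y →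
      x ≤ y := fun x y h => le_iff_compact_le_imp.2 fun c hc hcx =>
    (DFunLike.congr_fun h (opensIci c hc)).mp hcx
  exact fun x y h => le_antisymm (key x y h) (key y x h.symm)

theorem frameHom_apply_iff (p : FrameHom (Opens α) Prop) (U : Opens α) :
    p U ↔ ∃ c ∈ compactElementsOf p, c ∈ U := by
  constructor
  · intro hU
    have hcover : U = sSup {V | ∃ c, ∃ hc : IsCompactElement c, c ∈ U ∧ opensIci c hc = V} := by
      refine le_antisymm (fun x hx => ?_) (sSup_le ?_)
      · obtain ⟨c, hc, hcx, hcU⟩ := exists_isCompactElement_mem hx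
        exact Opens.mem_sSup.2 ⟨_, ⟨c, hc, hcU, rfl⟩, hcx⟩
      · rintro _ ⟨c, hc, hcU, rfl⟩
        exact opensIci_le hcU
    rw [hcover, map_sSup, sSup_Prop_eq] at hU
    obtain ⟨_, ⟨_, ⟨c, hc, hcU, rfl⟩, rfl⟩, hpc⟩ := hU
    exact ⟨c, ⟨hc, hpc⟩, hcU⟩
  · rintro ⟨c, ⟨hc, hpc⟩, hcU⟩
    exact OrderHomClass.mono p (opensIci_le (hc := hc) hcU) hpc

theorem compactElementsOf_nonempty (p : FrameHom (Opens α) Prop) :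
    (compactElementsOf p).Nonempty := by
  have htop : p ⊤ := by rw [map_top]; trivial
  obtain ⟨c, hc, -⟩ := (frameHom_apply_iff p ⊤).1 htop
  exact ⟨c, hc⟩

theorem directedOn_compactElementsOf (p : FrameHom (Opens α) Prop) :
    DirectedOn (· ≤ ·) (compactElementsOf p) := by
  rintro c ⟨hc, hpc⟩ d ⟨hd, hpd⟩
  have hinf : p (opensIci c hc ⊓ opensIci d hd) := by
    rw [map_inf]
    exact ⟨hpc, hpd⟩
  obtain ⟨e, he, hce, hde⟩ := (frameHom_apply_iff p _).1 hinf
  exact ⟨e, he, hce, hde⟩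

theorem localePointOfSpacePoint_surjective :
    Function.Surjective (Locale.localePointOfSpacePoint α) := by
  intro p
  refine ⟨sSup (compactElementsOf p), FrameHom.ext fun U => propext ?_⟩
  rw [frameHom_apply_iff p U]
  constructor
  · exact exists_mem_of_sSup_mem (compactElementsOf_nonempty p) (directedOn_compactElementsOf p)
  · rintro ⟨c, hc, hcU⟩
    exact isUpperSet_of_isOpen (D := Set.univ) U.isOpen (le_sSup hc) hcU

end Topology.IsScott

/-- A compactly generated complete lattice with its Scott topology is in bijection with the
points of its Scott locale: the map `x ↦ (U ↦ x ∈ U)` is a bijection onto the frame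
homomorphisms from the frame of Scott-open sets to `Prop`. -/
theorem stmt17 {α : Type*} [CompleteLattice α] [IsCompactlyGenerated α]
    [TopologicalSpace α] [Topology.IsScott α Set.univ] :
    ∃ e : α ≃ FrameHom (TopologicalSpace.Opens α) Prop,
      ∀ (x : α) (U : TopologicalSpace.Opens α), e x U ↔ x ∈ U :=
  ⟨Equiv.ofBijective (Locale.localePointOfSpacePoint α)
    ⟨Topology.IsScott.localePointOfSpacePoint_injective,
      Topology.IsScott.localePointOfSpacePoint_surjective⟩, fun _ _ => Iff.rfl⟩
end

section
/- Equip Prop with the Sierpiński topology (Mathlib's sierpinskiSpace, generated by the single open set {p : Prop | p}). For every frame L and every element a : L there exists a unique frame homomorphism f from the frame of open sets of the Sierpiński space to L such that f maps the open set {p : Prop | p} to a. (Thus the frame of opens of the Sierpiński space is the free frame on one generator, and the Sierpiński locale classifies the opens of every locale.) -/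
/-- The generating open set `{p | p}` of the Sierpiński space is open. -/
theorem sierpinski_generator_isOpen : IsOpen {p : Prop | p} := by
  have h : {p : Prop | p} = ({True} : Set Prop) := by
    ext p
    simp [eq_iff_iff]
  rw [h]
  exact isOpen_singleton_true

open TopologicalSpace

/-- An open of the Sierpiński space containing `False` is the whole space. -/
theorem sierpinski_opens_mem_of_false_mem {U : Opens Prop} (h : False ∈ U) (p : Prop) :
    p ∈ U := by
  have hspec : p ⤳ False := by
    rw [specializes_iff_nhds, nhds_false]
    exact le_top
  exact hspec.mem_open U.isOpen h

theorem sierpinski_opens_ext {U V : Opens Prop} (h₀ : False ∈ U ↔ False ∈ V)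
    (h₁ : True ∈ U ↔ True ∈ V) : U = V := by
  ext p
  by_cases hp : p
  · simpa [hp] using h₁
  · simpa [hp] using h₀

/-- The frame homomorphism out of the opens of the Sierpiński space sending `{p | p}` to `a`. -/
def sierpinskiLift {L : Type*} [Order.Frame L] (a : L) : FrameHom (Opens Prop) L where
  toFun U := (⨆ _ : False ∈ U, ⊤) ⊔ ⨆ _ : True ∈ U, a
  map_inf' U V := by
    have hU := fun h => sierpinski_opens_mem_of_false_mem (U := U) h True
    have hV := fun h => sierpinski_opens_mem_of_false_mem (U := V) h True
    by_cases h₁ : False ∈ U <;> by_cases h₂ : False ∈ V <;>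
      by_cases h₃ : True ∈ U <;> by_cases h₄ : True ∈ V <;> simp_all
  map_top' := by simp
  map_sSup' S := by
    apply le_antisymm
    · refine sup_le (iSup_le fun h => ?_) (iSup_le fun h => ?_) <;>
        obtain ⟨U, hU, hmem⟩ := Opens.mem_sSup.1 h
      · exact le_trans (le_sup_of_le_left (le_iSup_of_le hmem le_rfl))
          (le_sSup (Set.mem_image_of_mem _ hU))
      · exact le_trans (le_sup_of_le_right (le_iSup_of_le hmem le_rfl))
          (le_sSup (Set.mem_image_of_mem _ hU))
    · refine sSup_le ?_
      rintro _ ⟨U, hU, rfl⟩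
      exact sup_le_sup (iSup_mono' fun h => ⟨Opens.mem_sSup.2 ⟨U, hU, h⟩, le_rfl⟩)
        (iSup_mono' fun h => ⟨Opens.mem_sSup.2 ⟨U, hU, h⟩, le_rfl⟩)

theorem sierpinskiLift_apply {L : Type*} [Order.Frame L] (a : L) (U : Opens Prop) :
    sierpinskiLift a U = (⨆ _ : False ∈ U, ⊤) ⊔ ⨆ _ : True ∈ U, a := rfl

theorem sierpinskiLift_generator {L : Type*} [Order.Frame L] (a : L) :
    sierpinskiLift a ⟨{p : Prop | p}, sierpinski_generator_isOpen⟩ = a := by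
  simp [sierpinskiLift_apply, ← SetLike.mem_coe]

/-- Every open of the Sierpiński space is the whole space, the generator or empty. -/
theorem sierpinski_opens_eq (U : Opens Prop) :
    U = ⊤ ∨ U = ⟨{p : Prop | p}, sierpinski_generator_isOpen⟩ ∨ U = ⊥ := by
  by_cases h₀ : False ∈ U
  · have h₁ := sierpinski_opens_mem_of_false_mem h₀ True
    exact .inl (sierpinski_opens_ext (by simp [h₀]) (by simp [h₁]))
  by_cases h₁ : True ∈ U
  · exact .inr (.inl (sierpinski_opens_ext (by simp [h₀, ← SetLike.mem_coe (p := Opens.mk _ _)])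
      (by simp [h₁, ← SetLike.mem_coe (p := Opens.mk _ _)])))
  · exact .inr (.inr (sierpinski_opens_ext (by simp [h₀]) (by simp [h₁])))

/-- The frame of opens of the Sierpiński space is the free frame on one generator: for every
frame `L` and every `a : L`, there is a unique frame homomorphism from the opens of the
Sierpiński space to `L` sending the open `{p | p}` to `a`. -/
theorem stmt19 (L : Type*) [Order.Frame L] (a : L) :
    ∃! f : FrameHom (TopologicalSpace.Opens Prop) L,
      f ⟨{p : Prop | p}, sierpinski_generator_isOpen⟩ = a := by
  refine ⟨sierpinskiLift a, sierpinskiLift_generator a, fun g hg => ?_⟩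
  ext U
  obtain rfl | rfl | rfl := sierpinski_opens_eq U
  · rw [map_top, map_top]
  · rw [hg, sierpinskiLift_generator]
  · rw [map_bot, map_bot]
end
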